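/- There exist constants C > 0 and k₀ such that for every integer k ≥ k₀ and every real j with |j| ≤ √k for which m := k/e + j is an integer in {1,…,k}, one has | f(k,m) − [ 1/e − (1/(2e) − 1/2 + e·j²/(2k))·(1/k) ] | ≤ C·k^{−3/2}. -/

import Mathlib

/-- The `j`-th harmonic number `H_j = Σ_{i=1}^j 1/i` (with `H_0 = 0`). -/
noncomputable def harm (j : ℕ) : ℝ := ∑ i ∈ Finset.range j, (1 : ℝ) / (i + 1)

/-- `f(k,m) = (m/k)·(H_{k−1} − H_{m−1})`. -/
noncomputable def f (k m : ℕ) : ℝ := ((m : ℝ) / k) * (harm (k - 1) - harm (m - 1))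

theorem harm_succ (n : ℕ) : harm (n + 1) = harm n + 1 / ((n : ℝ) + 1) :=
  Finset.sum_range_succ _ _

/-- The trapezoidal rule for `∫ 1/x` over `[n, n+1]` overestimates the integral. -/
theorem log_succ_sub_log_le {n : ℝ} (hn : 0 < n) :
    Real.log (n + 1) - Real.log n ≤ 1 / (2 * n) + 1 / (2 * (n + 1)) := by
  rw [← Real.log_div (by positivity) hn.ne']
  have hy : 1 ≤ (n + 1) / n := by
    rw [le_div_iff₀ hn]
    linarith
  have h := Real.self_le_sinh_iff.2 (Real.log_nonneg hy)
  rw [Real.sinh_log (by positivity)] at h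
  refine h.trans_eq ?_
  field_simp
  ring

theorem trapezoid_sub_log_le {n : ℝ} (hn : 0 < n) :
    1 / (2 * n) + 1 / (2 * (n + 1)) - (Real.log (n + 1) - Real.log n) ≤
      1 / n ^ 2 - 1 / (n + 1) ^ 2 := by
  rw [← Real.log_div (by positivity) hn.ne']
  have h := Real.le_log_one_add_of_nonneg (x := 1 / n) (by positivity)
  rw [show 1 + 1 / n = (n + 1) / n by field_simp,
    show 2 * (1 / n) / (1 / n + 2) = 2 / (2 * n + 1) by field_simp; ring] at h
  have key : 1 / n ^ 2 - 1 / (n + 1) ^ 2 -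
      (1 / (2 * n) + 1 / (2 * (n + 1)) - 2 / (2 * n + 1)) =
      (2 * (2 * n + 1) ^ 2 - n * (n + 1)) / (2 * n ^ 2 * (n + 1) ^ 2 * (2 * n + 1)) := by
    field_simp
    ring
  have : 0 ≤ (2 * (2 * n + 1) ^ 2 - n * (n + 1)) /
      (2 * n ^ 2 * (n + 1) ^ 2 * (2 * n + 1)) := by
    apply div_nonneg _ (by positivity)
    nlinarith
  linarith

/-- Second-order expansion of differences of harmonic numbers. -/
theorem harm_sub_harm_bounds {m k : ℕ} (hm : 1 ≤ m) (hmk : m ≤ k) :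
    0 ≤ harm (k - 1) - harm (m - 1) -
        (Real.log k - Real.log m + 1 / (2 * (m : ℝ)) - 1 / (2 * (k : ℝ))) ∧
      harm (k - 1) - harm (m - 1) -
        (Real.log k - Real.log m + 1 / (2 * (m : ℝ)) - 1 / (2 * (k : ℝ))) ≤
      1 / (m : ℝ) ^ 2 - 1 / (k : ℝ) ^ 2 := by
  induction k, hmk using Nat.le_induction with
  | base => constructor <;> ring_nf <;> rfl
  | succ n hmn ih =>
    have hn : (0 : ℝ) < n := by exact_mod_cast hm.trans hmn
    have hs : harm n = harm (n - 1) + 1 / (n : ℝ) := by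
      obtain ⟨p, rfl⟩ := Nat.exists_eq_add_of_le' (hm.trans hmn)
      simpa using harm_succ p
    have h1 := log_succ_sub_log_le hn
    have h2 := trapezoid_sub_log_le hn
    have h3 : 1 / (n : ℝ) = 1 / (2 * n) + 1 / (2 * n) := by
      field_simp
      norm_num
    push_cast
    rw [hs]
    constructor <;> linarith [ih.1, ih.2]

theorem abs_log_one_add_sub_le {u : ℝ} (hu : |u| ≤ 1 / 2) :
    |Real.log (1 + u) - (u - u ^ 2 / 2)| ≤ 2 * |u| ^ 3 := by
  have h := Real.abs_log_sub_add_sum_range_le (x := -u) (by rw [abs_neg]; linarith) 2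
  simp only [Finset.sum_range_succ, Finset.sum_range_zero, abs_neg, sub_neg_eq_add] at h
  norm_num at h
  have h2 : |u| ^ 3 / (1 - |u|) ≤ 2 * |u| ^ 3 := by
    rw [div_le_iff₀ (by linarith)]
    nlinarith [pow_nonneg (abs_nonneg u) 3]
  refine le_trans (le_of_eq ?_) (h.trans h2)
  congr 1
  ring

/-- **Asymptotic expansion of `f(k, k/e + j)`.**
There are constants `C > 0` and `k₀` such that for all `k ≥ k₀` and all real `j`
with `|j| ≤ √k` for which `m = k/e + j` is an integer in `{1,…,k}`:
`|f(k,m) − (1/e − (1/(2e) − 1/2 + e·j²/(2k))·(1/k))| ≤ C·k^{−3/2}`. -/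
theorem f_expansion :
    ∃ C : ℝ, 0 < C ∧ ∃ k₀ : ℕ, ∀ k : ℕ, k₀ ≤ k →
      ∀ j : ℝ, |j| ≤ Real.sqrt k →
      ∀ m : ℕ, 1 ≤ m → m ≤ k → (m : ℝ) = (k : ℝ) / Real.exp 1 + j →
      |f k m - (1 / Real.exp 1 -
          (1 / (2 * Real.exp 1) - 1 / 2 + Real.exp 1 * j ^ 2 / (2 * k)) * (1 / (k : ℝ)))| ≤
        C * (k : ℝ) ^ (-(3 : ℝ) / 2) := by
  refine ⟨110, by norm_num, 36, fun k hk j hj m hm hmk hmj => ?_⟩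
  have he2 := Real.exp_one_gt_two
  have he3 := Real.exp_one_lt_three
  have hlogexp : Real.log (Real.exp 1) = 1 := Real.log_exp 1
  set e := Real.exp 1
  set s := Real.sqrt k
  have hk36 : (36 : ℝ) ≤ k := by exact_mod_cast hk
  have hs6 : 6 ≤ s := Real.le_sqrt_of_sq_le (by linarith)
  have hs0 : 0 < s := by linarith
  have hks : (k : ℝ) = s ^ 2 := (Real.sq_sqrt (by positivity)).symm
  have hpow : (k : ℝ) ^ (-(3 : ℝ) / 2) = 1 / s ^ 3 := by
    rw [hks, ← Real.rpow_natCast, ← Real.rpow_mul hs0.le,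
      show ((2 : ℕ) : ℝ) * (-3 / 2) = -((3 : ℕ) : ℝ) by norm_num, Real.rpow_neg hs0.le,
      Real.rpow_natCast, one_div]
  have hk0 : (0 : ℝ) < k := by linarith
  have he0 : 0 < e := by linarith
  have hm0 : (0 : ℝ) < m := by exact_mod_cast hm
  obtain ⟨u, hu⟩ : ∃ u, u = e * j / k := ⟨_, rfl⟩
  have hju : j = u * k / e := by
    rw [hu]
    field_simp
  have hmu : (m : ℝ) = k * (1 + u) / e := by
    rw [hmj, hju]
    ring
  have hus : |u| ≤ 3 / s := by
    rw [hu, abs_div, abs_mul, abs_of_pos he0, abs_of_pos hk0, div_le_div_iff₀ hk0 hs0, hks]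
    nlinarith [mul_le_mul he3.le hj (abs_nonneg j) (by norm_num)]
  have hu2 : |u| ≤ 1 / 2 := hus.trans (by rw [div_le_iff₀ hs0]; linarith)
  obtain ⟨hul, hur⟩ := abs_le.1 hu2
  have hu1 : 0 < 1 + u := by linarith
  have hlog : Real.log m = Real.log k + Real.log (1 + u) - 1 := by
    rw [hmu, Real.log_div (by positivity) he0.ne', Real.log_mul hk0.ne' hu1.ne', hlogexp]
  obtain ⟨R, hR⟩ : ∃ R, R = Real.log (1 + u) - (u - u ^ 2 / 2) := ⟨_, rfl⟩
  have hRb : |R| ≤ 2 * |u| ^ 3 := hR ▸ abs_log_one_add_sub_le hu2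
  obtain ⟨E, hE⟩ : ∃ E, E = harm (k - 1) - harm (m - 1) -
      (Real.log k - Real.log m + 1 / (2 * (m : ℝ)) - 1 / (2 * (k : ℝ))) := ⟨_, rfl⟩
  have hEb := harm_sub_harm_bounds hm hmk
  rw [← hE] at hEb
  have hEm : E ≤ 1 / (m : ℝ) ^ 2 := hEb.2.trans (sub_le_self _ (by positivity))
  have hH : harm (k - 1) - harm (m - 1) =
      1 - (u - u ^ 2 / 2 + R) + 1 / (2 * (m : ℝ)) - 1 / (2 * (k : ℝ)) + E := by
    rw [hE, hlog, hR]
    ring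
  have hdiff : f k m - (1 / e - (1 / (2 * e) - 1 / 2 + e * j ^ 2 / (2 * k)) * (1 / (k : ℝ))) =
      (u ^ 3 / 2 - (1 + u) * R) / e + (1 + u) / e * E - u / (2 * e * k) := by
    rw [f, hH, hmu, hju]
    field_simp
    ring
  have hu3 : |u| ^ 3 ≤ 27 / s ^ 3 := by
    calc |u| ^ 3 ≤ (3 / s) ^ 3 := by gcongr
      _ = 27 / s ^ 3 := by rw [div_pow]; norm_num
  have hA : |(u ^ 3 / 2 - (1 + u) * R) / e| ≤ 95 / s ^ 3 := by
    rw [abs_div, abs_of_pos he0]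
    refine (div_le_self (abs_nonneg _) (by linarith)).trans ?_
    have h1 : |u ^ 3 / 2| = |u| ^ 3 / 2 := by rw [abs_div, abs_pow, abs_two]
    have h2 : |(1 + u) * R| ≤ 3 / 2 * (2 * |u| ^ 3) := by
      rw [abs_mul, abs_of_pos hu1]
      gcongr
      linarith
    calc |u ^ 3 / 2 - (1 + u) * R| ≤ |u ^ 3 / 2| + |(1 + u) * R| := abs_sub _ _
      _ ≤ 7 / 2 * (27 / s ^ 3) := by linarith
      _ ≤ 95 / s ^ 3 := by
        rw [← mul_div_assoc]
        gcongr
        norm_num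
  have hB : |(1 + u) / e * E| ≤ 6 / s ^ 3 := by
    rw [abs_of_nonneg (mul_nonneg (by positivity) hEb.1)]
    calc (1 + u) / e * E ≤ (1 + u) / e * (1 / (m : ℝ) ^ 2) := by gcongr
      _ = (e / (1 + u)) / s ^ 4 := by
        rw [hmu, hks]
        field_simp
      _ ≤ 6 / s ^ 3 := by
        gcongr
        · rw [div_le_iff₀ hu1]
          linarith
        · linarith
        · norm_num
  have hC : |u / (2 * e * k)| ≤ 3 / s ^ 3 := by
    rw [abs_div, abs_of_pos (by positivity : 0 < 2 * e * k)]
    calc |u| / (2 * e * k) ≤ (3 / s) / (1 * k) := by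
          gcongr
          linarith
      _ = 3 / s ^ 3 := by
        rw [hks]
        field_simp
  rw [hdiff, hpow]
  calc _ ≤ |(u ^ 3 / 2 - (1 + u) * R) / e| + |(1 + u) / e * E| + |u / (2 * e * k)| :=
        (abs_sub _ _).trans (by gcongr; exact abs_add_le _ _)
    _ ≤ 95 / s ^ 3 + 6 / s ^ 3 + 3 / s ^ 3 := by gcongr
    _ ≤ 110 * (1 / s ^ 3) := by
      rw [← add_div, ← add_div, mul_one_div]
      gcongr
      norm_num
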